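/- arXiv:2203.11002 — 3 statements merged into one kernel-verified Lean document; each statement's English description precedes it below -/
import Mathlib

section
/- Let d ≥ 1 and let λ be a partition of n ≥ 1. Then the class function on S_n whose value on permutations of cycle type μ is χ^{d·λ}_{d·μ} is a genuine character of S_n; that is, there exist nonnegative integers a_ν, one for each partition ν of n, such that for every partition μ of n one has χ^{d·λ}_{d·μ} = Σ_{ν ⊢ n} a_ν · χ^ν_μ. -/
open MvPolynomial Finset

/-- The `r`-th power sum polynomial `p_r = x_1^r + ⋯ + x_N^r`. -/
noncomputable def psum (N r : ℕ) : MvPolynomial (Fin N) ℤ := ∑ i, X i ^ r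

/-- The power sum product `p_μ = p_{μ_1} ⋯ p_{μ_k}` for a partition `μ`. -/
noncomputable def pprod (N : ℕ) {n : ℕ} (mu : Nat.Partition n) : MvPolynomial (Fin N) ℤ :=
  (mu.parts.map (psum N)).prod

/-- The Vandermonde product `∏_{i<j} (x_i - x_j)`. -/
noncomputable def vandermonde (N : ℕ) : MvPolynomial (Fin N) ℤ :=
  ∏ p ∈ univ.filter (fun p : Fin N × Fin N => p.1 < p.2), (X p.1 - X p.2)

/-- The irreducible character value `χ^λ_μ` of `S_N`, via the Frobenius character formula:
the coefficient of `x_1^{λ_1 + N - 1} x_2^{λ_2 + N - 2} ⋯ x_N^{λ_N}` in `∏_{i<j}(x_i - x_j) ⋅ p_μ`,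
where `λ` is padded with trailing zeros to length `N`. -/
noncomputable def chi {N : ℕ} (l m : Nat.Partition N) : ℤ :=
  coeff (Finsupp.equivFunOnFinite.symm fun i : Fin N =>
    (l.parts.sort (· ≥ ·)).getD i 0 + (N - 1 - (i : ℕ))) (vandermonde N * pprod N m)

/-- `d⋅λ`: multiply every part of `λ` by `d`; a partition of `dn`. -/
def scale (d : ℕ) (hd : 0 < d) {n : ℕ} (P : Nat.Partition n) : Nat.Partition (d * n) where
  parts := P.parts.map (d * ·)
  parts_pos := by
    intro i hi
    obtain ⟨p, hp, rfl⟩ := Multiset.mem_map.mp hi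
    exact Nat.mul_pos hd (P.parts_pos hp)
  parts_sum := by rw [Multiset.sum_map_mul_left, Multiset.map_id', P.parts_sum]

/-- The part of the `i`-th content of the chain of row vectors `g` that lies in the rows below `r`:
the number of boxes added in rows `q < r` on passing from `g i` to `g (i + 1)`. -/
def partialContent (g : ℕ → ℕ → ℤ) (i r : ℕ) : ℤ := ∑ q ∈ range r, (g (i + 1) q - g i q)

/-- A chain `0 = g 0 ⊆ g 1 ⊆ ⋯ ⊆ g N = ν` of row vectors whose successive differences are
horizontal strips, i.e. a semistandard tableau of shape `ν` with entries in `0, …, N - 1`. -/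
structure IsStripChain (N : ℕ) (ν : ℕ → ℤ) (g : ℕ → ℕ → ℤ) : Prop where
  zero : g 0 = 0
  top : ∀ i, N ≤ i → g i = ν
  le : ∀ i < N, ∀ q, g i q ≤ g (i + 1) q
  strip : ∀ i < N, ∀ q, g (i + 1) (q + 1) ≤ g i q

namespace IsStripChain
variable {N : ℕ} {ν : ℕ → ℤ} {g : ℕ → ℕ → ℤ}

theorem nonneg (h : IsStripChain N ν g) {i : ℕ} (hi : i ≤ N) (q : ℕ) : 0 ≤ g i q := by
  induction i with
  | zero => simp [h.zero]
  | succ i ih => exact (ih (by omega)).trans (h.le i (by omega) q)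

theorem le_top (h : IsStripChain N ν g) {i : ℕ} (hi : i ≤ N) (q : ℕ) : g i q ≤ ν q := by
  induction hi using Nat.decreasingInduction with
  | self => rw [h.top N le_rfl]
  | of_succ i hi ih => exact (h.le i hi q).trans ih

theorem partialContent_nonneg (h : IsStripChain N ν g) {i : ℕ} (hi : i < N) (r : ℕ) :
    0 ≤ partialContent g i r :=
  sum_nonneg fun q _ => sub_nonneg.2 (h.le i hi q)

theorem eq_zero (h : IsStripChain N ν g) {i q : ℕ} (hi : i ≤ N) (hq : ν q = 0) : g i q = 0 :=
  le_antisymm (hq ▸ h.le_top hi q) (h.nonneg hi q)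

end IsStripChain

theorem finite_isStripChain (N n : ℕ) {ν : ℕ → ℤ} (hν : ∀ q, n ≤ q → ν q = 0) :
    {g | IsStripChain N ν g}.Finite := by
  refine Set.Finite.of_injOn (f := fun g (i : Fin N) (q : Fin n) => g i q)
    (t := Set.univ.pi fun _ : Fin N => Set.univ.pi fun q : Fin n => Set.Icc 0 (ν q)) ?_ ?_
    (Set.Finite.pi fun _ => Set.Finite.pi fun _ => Set.finite_Icc _ _)
  · intro g hg i _ q _
    exact ⟨hg.nonneg i.2.le q, hg.le_top i.2.le q⟩
  · intro g hg g' hg' h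
    funext i q
    by_cases hi : i < N
    · by_cases hq : q < n
      · exact congrFun (congrFun h ⟨i, hi⟩) ⟨q, hq⟩
      · rw [hg.eq_zero hi.le (hν q (by omega)), hg'.eq_zero hi.le (hν q (by omega))]
    · rw [hg.top i (by omega), hg'.top i (by omega)]

/-- The reflection of the row vector `m` in the interval of row vectors between `l` and `u`,
restricted to rows `≥ r`, where row `r` is reflected in `[max (l r) (u (r + 1)), u r - s]`. -/
def toggleRow (r : ℕ) (s : ℤ) (l u m : ℕ → ℤ) (q : ℕ) : ℤ :=
  if q < r then m q
  else if q = r then max (l q) (u (q + 1)) + (u q - s) - m q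
  else max (l q) (u (q + 1)) + min (l (q - 1)) (u q) - m q

theorem toggleRow_of_lt {r : ℕ} {s : ℤ} {l u m : ℕ → ℤ} {q : ℕ} (h : q < r) :
    toggleRow r s l u m q = m q := if_pos h

theorem toggleRow_toggleRow (r : ℕ) (s : ℤ) (l u m : ℕ → ℤ) :
    toggleRow r s l u (toggleRow r s l u m) = m := by
  funext q
  unfold toggleRow
  split_ifs <;> ring

theorem sum_toggleRow {r n : ℕ} (hr : r < n) (s : ℤ) (l u m : ℕ → ℤ) (hu : u n = 0)
    (hl : 0 ≤ l (n - 1)) :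
    ∑ q ∈ range n, toggleRow r s l u m q + ∑ q ∈ range n, m q =
      2 * ∑ q ∈ range r, m q + (∑ q ∈ range n, l q + ∑ q ∈ range n, u q) -
        (∑ q ∈ range r, l q + ∑ q ∈ range r, u q) - s := by
  have key : ∀ k, ∑ q ∈ range (r + k + 1), toggleRow r s l u m q + ∑ q ∈ range (r + k + 1), m q =
      2 * ∑ q ∈ range r, m q + (∑ q ∈ range (r + k + 1), l q + ∑ q ∈ range (r + k + 1), u q) -
        (∑ q ∈ range r, l q + ∑ q ∈ range r, u q) - s +
        (max (l (r + k)) (u (r + k + 1)) - l (r + k)) := by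
    intro k
    induction k with
    | zero =>
      have : ∑ q ∈ range r, toggleRow r s l u m q = ∑ q ∈ range r, m q :=
        sum_congr rfl fun q hq => toggleRow_of_lt (mem_range.1 hq)
      simp only [Nat.add_zero, sum_range_succ, this]
      simp only [toggleRow, lt_irrefl, if_false, if_true]
      ring
    | succ k ih =>
      have h1 : toggleRow r s l u m (r + k + 1) = max (l (r + k + 1)) (u (r + k + 1 + 1)) +
          min (l (r + k)) (u (r + k + 1)) - m (r + k + 1) := by
        rw [toggleRow, if_neg (by omega), if_neg (by omega), Nat.add_sub_cancel]
      have h2 := max_add_min (l (r + k)) (u (r + k + 1))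
      rw [← add_assoc r k 1, sum_range_succ _ (r + k + 1), sum_range_succ m (r + k + 1),
        sum_range_succ l (r + k + 1), sum_range_succ u (r + k + 1), h1]
      linarith
  obtain ⟨k, rfl⟩ : ∃ k, n = r + k + 1 := ⟨n - r - 1, by omega⟩
  rw [Nat.add_sub_cancel] at hl
  rw [key k, hu, max_eq_left hl]
  ring

/-- Replace the member `g (i + 1)` of a chain by its reflection between `g i` and `g (i + 2)`. -/
def toggle (i r : ℕ) (s : ℤ) (g : ℕ → ℕ → ℤ) : ℕ → ℕ → ℤ :=
  Function.update g (i + 1) (toggleRow r s (g i) (g (i + 2)) (g (i + 1)))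

section toggle
variable {N n i r : ℕ} {s : ℤ} {ν : ℕ → ℤ} {g : ℕ → ℕ → ℤ}

theorem toggle_of_ne {j : ℕ} (h : j ≠ i + 1) : toggle i r s g j = g j :=
  Function.update_of_ne h _ _

theorem toggle_succ :
    toggle i r s g (i + 1) = toggleRow r s (g i) (g (i + 2)) (g (i + 1)) :=
  Function.update_self _ _ _

theorem toggle_of_lt {j q : ℕ} (h : q < r) : toggle i r s g j q = g j q := by
  by_cases hj : j = i + 1
  · rw [hj, toggle_succ, toggleRow_of_lt h]
  · rw [toggle_of_ne hj]

theorem toggle_toggle : toggle i r s (toggle i r s g) = g := by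
  funext j
  by_cases hj : j = i + 1
  · subst hj
    rw [toggle_succ, toggle_succ, toggle_of_ne (by omega), toggle_of_ne (by omega),
      toggleRow_toggleRow]
  · rw [toggle_of_ne hj, toggle_of_ne hj]

theorem IsStripChain.toggle (h : IsStripChain N ν g) (hi : i + 1 < N) (hs : 0 ≤ s)
    (hr : g (i + 1) r ≤ g (i + 2) r - s) (hr' : ∀ q, q + 1 = r → g (i + 2) r - s ≤ g i q) :
    IsStripChain N ν (toggle i r s g) := by
  have l1 := h.le i (by omega)
  have l2 := h.le (i + 1) hi
  have s1 := h.strip i (by omega)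
  have s2 := h.strip (i + 1) hi
  refine ⟨?_, ?_, ?_, ?_⟩
  · rw [toggle_of_ne (by omega), h.zero]
  · intro j hj
    rw [toggle_of_ne (by omega), h.top j hj]
  · intro j hj q
    by_cases h1 : j = i + 1
    · subst h1
      rw [toggle_succ, toggle_of_ne (by omega)]
      have := l1 q; have := l2 q; have := s1 q; have := s2 q
      unfold toggleRow
      split_ifs with h1 h2
      · exact l2 q
      · subst h2; grind
      · grind
    · by_cases h2 : j = i
      · subst h2
        rw [toggle_succ, toggle_of_ne (by omega)]
        have := l1 q; have := l2 q; have := s1 q; have := s2 q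
        unfold toggleRow
        split_ifs with h1 h2
        · assumption
        · subst h2; grind
        · have := s1 (q - 1); have := l2 q
          rw [Nat.sub_add_cancel (by omega)] at *
          grind
      · rw [toggle_of_ne h1, toggle_of_ne (by omega)]
        exact h.le j hj q
  · intro j hj q
    by_cases h1 : j = i + 1
    · subst h1
      rw [toggle_succ, toggle_of_ne (by omega)]
      have := l1 q; have := l2 q; have := s1 q; have := s2 q
      unfold toggleRow
      split_ifs with h1 h2
      · assumption
      · subst h2; grind
      · have := s1 (q - 1); have := l2 q
        rw [Nat.sub_add_cancel (by omega)] at *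
        grind
    · by_cases h2 : j = i
      · subst h2
        rw [toggle_succ, toggle_of_ne (by omega)]
        have := l1 (q + 1); have := l2 (q + 1); have := s1 (q + 1); have := s2 (q + 1)
        have := s1 q
        unfold toggleRow
        split_ifs with h1 h2
        · assumption
        · have := hr' q h2; subst h2; grind
        · rw [Nat.add_sub_cancel]
          grind
      · rw [toggle_of_ne h1, toggle_of_ne (by omega)]
        exact h.strip j hj q

theorem partialContent_toggle_of_ne {j : ℕ} (h1 : j ≠ i) (h2 : j ≠ i + 1) (k : ℕ) :
    partialContent (toggle i r s g) j k = partialContent g j k := by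
  unfold partialContent
  rw [toggle_of_ne (by omega), toggle_of_ne (by omega)]

theorem partialContent_toggle_of_le {j k : ℕ} (h : k ≤ r) :
    partialContent (toggle i r s g) j k = partialContent g j k := by
  refine sum_congr rfl fun q hq => ?_
  rw [mem_range] at hq
  rw [toggle_of_lt (by omega), toggle_of_lt (by omega)]

theorem partialContent_toggle_self (hr : r < n) (hu : g (i + 2) n = 0) (hl : 0 ≤ g i (n - 1)) :
    partialContent (toggle i r s g) i n =
      partialContent g (i + 1) n + (partialContent g i r - partialContent g (i + 1) r - s) := by
  have := sum_toggleRow hr s (g i) (g (i + 2)) (g (i + 1)) hu hl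
  simp only [partialContent, toggle_succ, toggle_of_ne (show i ≠ i + 1 by omega),
    sum_sub_distrib]
  linarith

theorem partialContent_toggle_succ (hr : r < n) (hu : g (i + 2) n = 0) (hl : 0 ≤ g i (n - 1)) :
    partialContent (toggle i r s g) (i + 1) n =
      partialContent g i n - (partialContent g i r - partialContent g (i + 1) r - s) := by
  have := sum_toggleRow hr s (g i) (g (i + 2)) (g (i + 1)) hu hl
  simp only [partialContent, toggle_succ, toggle_of_ne (show i + 1 + 1 ≠ i + 1 by omega),
    sum_sub_distrib]
  linarith

end toggle

/-- The finite set of horizontal strip chains of length `N` ending in `ν`. -/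
noncomputable def stripChains (N : ℕ) {n : ℕ} {ν : ℕ → ℤ} (hν : ∀ q, n ≤ q → ν q = 0) :
    Finset (ℕ → ℕ → ℤ) := (finite_isStripChain N n hν).toFinset

section count
variable {N n : ℕ} {ν : ℕ → ℤ} (hν : ∀ q, n ≤ q → ν q = 0)

theorem mem_stripChains {g : ℕ → ℕ → ℤ} : g ∈ stripChains N hν ↔ IsStripChain N ν g := by
  simp [stripChains]

/-- The number of strip chains whose content, multiplied by `d`, is `c`. -/
noncomputable def contentCount (d : ℤ) (c : Fin N → ℤ) : ℕ :=
  #{g ∈ stripChains N hν | ∀ k : Fin N, d * partialContent g k n = c k}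

theorem IsStripChain.toggle_zero {g : ℕ → ℕ → ℤ} (h : IsStripChain N ν g) {i : ℕ}
    (hi : i + 1 < N) : IsStripChain N ν (_root_.toggle i 0 0 g) :=
  h.toggle hi le_rfl (by simpa using h.le (i + 1) hi 0) (by simp)

theorem contentCount_comp_swap_le (hn : 0 < n) (d : ℤ) {i : ℕ} (hi : i + 1 < N) (c : Fin N → ℤ) :
    contentCount hν d (c ∘ Equiv.swap ⟨i, by omega⟩ ⟨i + 1, hi⟩) ≤ contentCount hν d c := by
  refine card_le_card_of_injOn (toggle i 0 0) ?_ ?_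
  · intro g hg
    simp only [coe_filter, Set.mem_ofPred_eq, mem_stripChains] at hg ⊢
    obtain ⟨hg, hc⟩ := hg
    refine ⟨hg.toggle_zero hi, fun k => ?_⟩
    have hu : g (i + 2) n = 0 := hg.eq_zero (by omega) (hν n le_rfl)
    have hl : 0 ≤ g i (n - 1) := hg.nonneg (by omega) _
    by_cases h1 : (k : ℕ) = i
    · have := hc ⟨i + 1, hi⟩
      rw [show k = ⟨i, by omega⟩ from Fin.ext h1]
      simp only [Function.comp, Equiv.swap_apply_right] at this
      rw [partialContent_toggle_self hn hu hl, ← this]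
      simp [partialContent]
    · by_cases h2 : (k : ℕ) = i + 1
      · have := hc ⟨i, by omega⟩
        rw [show k = ⟨i + 1, by omega⟩ from Fin.ext h2]
        simp only [Function.comp, Equiv.swap_apply_left] at this
        rw [partialContent_toggle_succ hn hu hl, ← this]
        simp [partialContent]
      · rw [partialContent_toggle_of_ne h1 h2, hc k, Function.comp,
          Equiv.swap_apply_of_ne_of_ne] <;> simpa [Fin.ext_iff]
  · intro g _ g' _ h
    simpa [toggle_toggle] using congrArg (toggle i 0 0) h

/-- Content counts are symmetric: the Bender–Knuth involutions permute the content. -/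
theorem contentCount_comp_perm (hn : 0 < n) (d : ℤ) (τ : Equiv.Perm (Fin N)) (c : Fin N → ℤ) :
    contentCount hν d (c ∘ τ) = contentCount hν d c := by
  obtain _ | N := N
  · congr 1
    exact Subsingleton.elim _ _
  have hτ : τ ∈ Submonoid.closure
      (Set.range fun i : Fin N => Equiv.swap i.castSucc i.succ) := by
    rw [Equiv.Perm.mclosure_swap_castSucc_succ]
    trivial
  induction hτ using Submonoid.closure_induction generalizing c with
  | one => rfl
  | mul x y _ _ hx hy => exact (hy (c ∘ x)).trans (hx c)
  | mem x hx =>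
    obtain ⟨i, rfl⟩ := hx
    have key := fun c => contentCount_comp_swap_le hν hn d (Nat.succ_lt_succ i.2) c
    refine le_antisymm (key c) (le_trans (le_of_eq ?_) (key _))
    congr 1
    funext k
    simp only [Function.comp]
    exact congrArg c (Equiv.symm_apply_apply (Equiv.swap i.castSucc i.succ) k).symm

end count

/-- The lattice condition fails at index `i` and row `r`: there are more boxes of entry `i + 1` in the
rows `≤ r` than boxes of entry `i` in the rows `< r`. -/
def IsViolation (g : ℕ → ℕ → ℤ) (i r : ℕ) : Prop :=
  partialContent g i r < partialContent g (i + 1) (r + 1)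

/-- The chain satisfies the lattice condition at all indices `i` in `A`. -/
def IsLattice (A : ℕ → Prop) (g : ℕ → ℕ → ℤ) : Prop := ∀ i r, A i → ¬ IsViolation g i r

/-- The first row in which the lattice condition on `A` fails. -/
noncomputable def violationRow (A : ℕ → Prop) (g : ℕ → ℕ → ℤ) : ℕ :=
  sInf {r | ∃ i, A i ∧ IsViolation g i r}

/-- The largest index in `A` at which the lattice condition fails in the row `violationRow A g`. -/
noncomputable def violationIndex (A : ℕ → Prop) (g : ℕ → ℕ → ℤ) : ℕ :=
  sSup {i | A i ∧ IsViolation g i (violationRow A g)}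

/-- The sign-reversing involution on chains that are not lattice: toggle the chain at the violation
index from the violation row on, with the shift that keeps the violation in place. -/
noncomputable def cancel (A : ℕ → Prop) (g : ℕ → ℕ → ℤ) : ℕ → ℕ → ℤ :=
  toggle (violationIndex A g) (violationRow A g)
    (partialContent g (violationIndex A g) (violationRow A g) -
      partialContent g (violationIndex A g + 1) (violationRow A g) + 1) g

section cancel
variable {N n : ℕ} {ν : ℕ → ℤ} {g : ℕ → ℕ → ℤ} {A : ℕ → Prop}

theorem violationIndex_spec (hA : ∀ i, A i → i + 1 < N) (hg : ¬ IsLattice A g) :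
    A (violationIndex A g) ∧ IsViolation g (violationIndex A g) (violationRow A g) := by
  have h1 : {r | ∃ i, A i ∧ IsViolation g i r}.Nonempty := by
    simp only [IsLattice, not_forall, not_not] at hg
    obtain ⟨i, r, h, h'⟩ := hg
    exact ⟨r, i, h, h'⟩
  exact Nat.sSup_mem (Nat.sInf_mem h1) ⟨N, fun i hi => by have := hA i hi.1; omega⟩

theorem not_isViolation_of_lt_violationRow {r i : ℕ} (hr : r < violationRow A g) (hi : A i) :
    ¬ IsViolation g i r := fun h => Nat.notMem_of_lt_sInf hr ⟨i, hi, h⟩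

theorem le_violationIndex (hA : ∀ i, A i → i + 1 < N) {i : ℕ} (hi : A i)
    (h : IsViolation g i (violationRow A g)) : i ≤ violationIndex A g :=
  le_csSup ⟨N, fun i hi => by have := hA i hi.1; omega⟩ ⟨hi, h⟩

theorem violationRow_eq {r : ℕ} (h : ∃ i, A i ∧ IsViolation g i r)
    (h' : ∀ r' < r, ∀ i, A i → ¬ IsViolation g i r') : violationRow A g = r := by
  refine le_antisymm (Nat.sInf_le h) (le_csInf ⟨r, h⟩ ?_)
  rintro r' ⟨i, hi, hv⟩
  by_contra hlt
  exact h' r' (by omega) i hi hv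

theorem violationIndex_eq {i : ℕ} (h : A i) (hv : IsViolation g i (violationRow A g))
    (h' : ∀ j, i < j → A j → ¬ IsViolation g j (violationRow A g)) : violationIndex A g = i := by
  have hle : ∀ j ∈ {i | A i ∧ IsViolation g i (violationRow A g)}, j ≤ i := by
    rintro j ⟨hj, hvj⟩
    by_contra hlt
    exact h' j (by omega) hj hvj
  exact le_antisymm (csSup_le ⟨i, h, hv⟩ hle) (le_csSup ⟨i, hle⟩ ⟨h, hv⟩)

theorem IsViolation.shift_le {i r : ℕ} (h : IsViolation g i r) :
    g (i + 1) r ≤ g (i + 2) r - (partialContent g i r - partialContent g (i + 1) r + 1) := by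
  unfold IsViolation at h
  rw [partialContent, partialContent, sum_range_succ] at h
  unfold partialContent
  linarith

theorem not_isViolation_shift (h : IsStripChain N ν g) {i r : ℕ} (hi : i + 1 < N)
    (hr : ∀ r' < r, ¬ IsViolation g i r') :
    0 ≤ partialContent g i r - partialContent g (i + 1) r ∧ ∀ q, q + 1 = r →
      g (i + 2) r - (partialContent g i r - partialContent g (i + 1) r + 1) ≤ g i q := by
  obtain _ | q := r
  · simp [partialContent]
  have h1 := hr q (by omega)
  rw [IsViolation, not_lt] at h1
  have h2 : partialContent g i (q + 1) = partialContent g i q + (g (i + 1) q - g i q) :=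
    sum_range_succ _ _
  have h3 := h.le i (by omega) q
  have h4 := h.strip (i + 1) hi q
  refine ⟨by linarith, fun q' hq' => ?_⟩
  obtain rfl : q' = q := by omega
  linarith

theorem isStripChain_cancel (h : IsStripChain N ν g) (hA : ∀ i, A i → i + 1 < N)
    (hg : ¬ IsLattice A g) : IsStripChain N ν (cancel A g) := by
  obtain ⟨hi, hv⟩ := violationIndex_spec hA hg
  obtain ⟨h1, h2⟩ := not_isViolation_shift h (hA _ hi)
    fun r' hr' => not_isViolation_of_lt_violationRow hr' hi
  exact h.toggle (hA _ hi) (by linarith) hv.shift_le h2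

theorem violation_cancel (h : IsStripChain N ν g) (hA : ∀ i, A i → i + 1 < N) (hg : ¬ IsLattice A g) :
    violationRow A (cancel A g) = violationRow A g ∧
      violationIndex A (cancel A g) = violationIndex A g ∧ ¬ IsLattice A (cancel A g) := by
  obtain ⟨hi, hv⟩ := violationIndex_spec hA hg
  have hv' : IsViolation (cancel A g) (violationIndex A g) (violationRow A g) := by
    unfold IsViolation cancel
    rw [partialContent_toggle_of_le le_rfl]
    rw [partialContent, partialContent, sum_range_succ, ← partialContent, ← partialContent,
      partialContent_toggle_of_le le_rfl, toggle_succ, toggle_of_ne (by omega)]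
    simp only [toggleRow, lt_irrefl, if_false, if_true]
    have h1 := h.le _ ((Nat.lt_succ_self _).trans (hA _ hi)) (violationRow A g)
    have h2 := h.strip _ (hA _ hi) (violationRow A g)
    have h3 := max_le h1 h2
    linarith
  have hrow : violationRow A (cancel A g) = violationRow A g := by
    refine violationRow_eq ⟨_, hi, hv'⟩ fun r' hr' i hi' => ?_
    have := not_isViolation_of_lt_violationRow hr' hi'
    unfold IsViolation cancel at *
    rwa [partialContent_toggle_of_le (by omega), partialContent_toggle_of_le (by omega)]
  refine ⟨hrow, violationIndex_eq hi (by rwa [hrow]) fun j hj hj' hvj => ?_,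
    fun h => h _ _ hi hv'⟩
  rw [hrow] at hvj
  have : IsViolation g j (violationRow A g) := by
    unfold IsViolation cancel at *
    rwa [partialContent_toggle_of_le le_rfl,
      partialContent_toggle_of_ne (by omega) (by omega)] at hvj
  have := le_violationIndex hA hj' this
  omega

theorem cancel_cancel (h : IsStripChain N ν g) (hA : ∀ i, A i → i + 1 < N) (hg : ¬ IsLattice A g) :
    cancel A (cancel A g) = g := by
  obtain ⟨h1, h2, -⟩ := violation_cancel h hA hg
  rw [cancel, h1, h2]
  unfold cancel
  rw [partialContent_toggle_of_le le_rfl, partialContent_toggle_of_le le_rfl, toggle_toggle]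

end cancel

section signedSum
variable {N n : ℕ} {ν : ℕ → ℤ} {A : ℕ → Prop}

theorem partialContent_cancel {g : ℕ → ℕ → ℤ} (hν : ∀ q, n ≤ q → ν q = 0)
    (h : IsStripChain N ν g) (hA : ∀ i, A i → i + 1 < N) (hg : ¬ IsLattice A g) :
    partialContent (cancel A g) (violationIndex A g) n =
        partialContent g (violationIndex A g + 1) n - 1 ∧
      partialContent (cancel A g) (violationIndex A g + 1) n =
        partialContent g (violationIndex A g) n + 1 := by
  obtain ⟨hi, hv⟩ := violationIndex_spec hA hg
  have hi' := hA _ hi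
  obtain ⟨h1, -⟩ := not_isViolation_shift h hi'
    fun r' hr' => not_isViolation_of_lt_violationRow hr' hi
  have hr : violationRow A g < n := by
    by_contra hr
    have h2 := hv.shift_le
    rw [h.eq_zero (show violationIndex A g + 2 ≤ N by omega) (hν _ (not_lt.1 hr))] at h2
    have := h.nonneg (show violationIndex A g + 1 ≤ N by omega) (violationRow A g)
    linarith
  have hu : g (violationIndex A g + 2) n = 0 := h.eq_zero (by omega) (hν n le_rfl)
  have hl : 0 ≤ g (violationIndex A g) (n - 1) := h.nonneg (by omega) _
  unfold cancel
  rw [partialContent_toggle_self hr hu hl, partialContent_toggle_succ hr hu hl]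
  constructor <;> ring

/-- The signed sum over pairs of a permutation and a strip chain reduces to the count of lattice
chains, provided that lattice chains only occur together with the identity permutation. -/
theorem sum_sign_eq_card (hν : ∀ q, n ≤ q → ν q = 0) (hA : ∀ i, A i → i + 1 < N) (d : ℤ)
    (R : ℕ → ℤ) (hR : ∀ i, A i → R i = R (i + 1) + d) (E : Fin N → ℤ)
    (hE : ∀ (w : Equiv.Perm (Fin N)) (g : ℕ → ℕ → ℤ), IsStripChain N ν g → IsLattice A g →
      (∀ k : Fin N, d * partialContent g k n + R k = E (w k)) → w = 1) :
    open Classical in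
    ∑ w : Equiv.Perm (Fin N), ∑ g ∈ stripChains N hν,
      (if ∀ k : Fin N, d * partialContent g k n + R k = E (w k) then
        (Equiv.Perm.sign w : ℤ) else 0) =
      #{g ∈ stripChains N hν | IsLattice A g ∧
        ∀ k : Fin N, d * partialContent g k n + R k = E k} := by
  classical
  rw [← sum_product', ← sum_filter, ← sum_filter_add_sum_filter_not _ (fun p => IsLattice A p.2)]
  have hbad : ∑ p ∈ {p ∈ {p ∈ (univ : Finset (Equiv.Perm (Fin N))) ×ˢ stripChains N hν |
      ∀ k : Fin N, d * partialContent p.2 k n + R k = E (p.1 k)} | ¬ IsLattice A p.2},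
      (Equiv.Perm.sign p.1 : ℤ) = 0 := by
    have hlt : ∀ p ∈ {p ∈ {p ∈ (univ : Finset (Equiv.Perm (Fin N))) ×ˢ stripChains N hν |
        ∀ k : Fin N, d * partialContent p.2 k n + R k = E (p.1 k)} | ¬ IsLattice A p.2},
        violationIndex A p.2 + 1 < N := by
      intro p hp
      simp only [mem_filter, mem_product, mem_univ, true_and, mem_stripChains] at hp
      exact hA _ (violationIndex_spec hA hp.2).1
    refine sum_involution (fun p hp => (p.1 * Equiv.swap ⟨violationIndex A p.2, by
      have := hlt p hp; omega⟩ ⟨violationIndex A p.2 + 1, hlt p hp⟩, cancel A p.2)) ?_ ?_ ?_ ?_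
    · intro p hp
      rw [Equiv.Perm.sign_mul, Equiv.Perm.sign_swap (by simp [Fin.ext_iff])]
      simp
    · intro p hp hne heq
      have := congrArg Prod.fst heq
      simp [Equiv.swap_eq_one_iff, Fin.ext_iff] at this
    · intro p hp
      have hlt' := hlt p hp
      simp only [mem_filter, mem_product, mem_univ, true_and, mem_stripChains] at hp ⊢
      obtain ⟨⟨hg, hc⟩, hbad⟩ := hp
      obtain ⟨h1, h2⟩ := partialContent_cancel hν hg hA hbad
      refine ⟨⟨isStripChain_cancel hg hA hbad, fun k => ?_⟩, (violation_cancel hg hA hbad).2.2⟩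
      have hRi := hR _ (violationIndex_spec hA hbad).1
      rw [Equiv.Perm.mul_apply]
      by_cases e1 : (k : ℕ) = violationIndex A p.2
      · have := hc ⟨violationIndex A p.2 + 1, hlt'⟩
        rw [show k = ⟨violationIndex A p.2, by omega⟩ from Fin.ext e1, Equiv.swap_apply_left,
          ← this]
        simp only [h1, hRi]
        ring
      · by_cases e2 : (k : ℕ) = violationIndex A p.2 + 1
        · have := hc ⟨violationIndex A p.2, by omega⟩
          rw [show k = ⟨violationIndex A p.2 + 1, by omega⟩ from Fin.ext e2,
            Equiv.swap_apply_right, ← this]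
          simp only [h2, hRi]
          ring
        · rw [Equiv.swap_apply_of_ne_of_ne (by simpa [Fin.ext_iff]) (by simpa [Fin.ext_iff]),
            ← hc k, cancel, partialContent_toggle_of_ne e1 e2]
    · intro p hp
      simp only [mem_filter, mem_product, mem_univ, true_and, mem_stripChains] at hp
      obtain ⟨⟨hg, hc⟩, hbad⟩ := hp
      have h2 := (violation_cancel hg hA hbad).2.1
      refine Prod.ext ?_ (cancel_cancel hg hA hbad)
      simp only [h2, mul_assoc, Equiv.swap_mul_self, mul_one]
  rw [hbad, add_zero, card_eq_sum_ones, Nat.cast_sum]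
  refine sum_bij' (fun p _ => p.2) (fun g _ => (1, g)) ?_ ?_ ?_ ?_ ?_
  · intro p hp
    simp only [mem_filter, mem_product, mem_univ, true_and] at hp ⊢
    have hw := hE p.1 p.2 ((mem_stripChains hν).1 hp.1.1) hp.2 hp.1.2
    refine ⟨hp.1.1, hp.2, fun k => ?_⟩
    simpa [hw] using hp.1.2 k
  · intro g hg
    simp only [mem_filter, mem_product, mem_univ, true_and] at hg ⊢
    exact ⟨⟨hg.1, hg.2.2⟩, hg.2.1⟩
  · intro p hp
    simp only [mem_filter, mem_product, mem_univ, true_and] at hp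
    exact Prod.ext (hE p.1 p.2 ((mem_stripChains hν).1 hp.1.1) hp.2 hp.1.2).symm rfl
  · intro g hg
    rfl
  · intro p hp
    simp only [mem_filter, mem_product, mem_univ, true_and] at hp
    simp [hE p.1 p.2 ((mem_stripChains hν).1 hp.1.1) hp.2 hp.1.2]

end signedSum

theorem vandermonde_eq_sum (N : ℕ) : vandermonde N = ∑ σ : Equiv.Perm (Fin N),
    monomial (Finsupp.equivFunOnFinite.symm fun i : Fin N => N - 1 - (σ i : ℕ))
      (Equiv.Perm.sign σ : ℤ) := by
  have h1 : vandermonde N = (Matrix.projVandermonde (1 : Fin N → MvPolynomial (Fin N) ℤ) X).det := by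
    rw [Matrix.det_projVandermonde, vandermonde, prod_filter, ← univ_product_univ, prod_product]
    refine prod_congr rfl fun i _ => ?_
    rw [← prod_filter]
    refine prod_congr (by ext; simp) fun j _ => by simp
  rw [h1, ← Matrix.det_transpose, Matrix.det_apply]
  refine sum_congr rfl fun σ _ => ?_
  rw [monomial_eq, Finsupp.prod_fintype _ _ (fun _ => pow_zero _)]
  simp [Matrix.projVandermonde_apply, Fin.val_rev, Units.smul_def, Nat.sub_sub, add_comm]

/-- The content of a chain as an exponent vector. -/
noncomputable def chainWeight (N n : ℕ) (g : ℕ → ℕ → ℤ) : Fin N →₀ ℕ :=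
  Finsupp.equivFunOnFinite.symm fun k => (partialContent g k n).toNat

/-- The Schur polynomial of `ν` in `N` variables, as the generating function of strip chains. -/
noncomputable def schurPoly (N : ℕ) {n : ℕ} {ν : ℕ → ℤ} (hν : ∀ q, n ≤ q → ν q = 0) :
    MvPolynomial (Fin N) ℤ := ∑ g ∈ stripChains N hν, monomial (chainWeight N n g) 1

section coeff
variable {N n d m : ℕ} {ν : ℕ → ℤ} (hν : ∀ q, n ≤ q → ν q = 0)

theorem coeff_schurPoly (e : Fin N →₀ ℕ) :
    coeff e (schurPoly N hν) = contentCount hν 1 fun k => (e k : ℤ) := by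
  classical
  rw [schurPoly, coeff_sum, contentCount, card_filter, Nat.cast_sum]
  refine sum_congr rfl fun g hg => ?_
  rw [mem_stripChains] at hg
  rw [coeff_monomial]
  push_cast
  refine if_congr ?_ rfl rfl
  rw [DFunLike.ext_iff]
  refine forall_congr' fun k => ?_
  have := hg.partialContent_nonneg k.2 n
  simp only [chainWeight, Finsupp.equivFunOnFinite_symm_apply_apply]
  omega

theorem coeff_vandermonde_mul_expand (E : Fin N →₀ ℕ) :
    coeff E (vandermonde N * expand d (schurPoly N hν)) =
      ∑ σ : Equiv.Perm (Fin N), (Equiv.Perm.sign σ : ℤ) *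
        contentCount hν d fun k => (E k : ℤ) - ((N - 1 - (σ k : ℕ) : ℕ) : ℤ) := by
  classical
  rw [vandermonde_eq_sum, sum_mul, coeff_sum]
  refine sum_congr rfl fun σ _ => ?_
  rw [schurPoly, map_sum, mul_sum, coeff_sum, contentCount, card_filter, Nat.cast_sum, mul_sum]
  refine sum_congr rfl fun g hg => ?_
  rw [mem_stripChains] at hg
  rw [expand_monomial, monomial_mul, coeff_monomial, mul_one, Nat.cast_ite, mul_ite]
  simp only [Nat.cast_one, Nat.cast_zero, mul_one, mul_zero]
  refine if_congr ?_ rfl rfl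
  rw [DFunLike.ext_iff]
  refine forall_congr' fun k => ?_
  have := hg.partialContent_nonneg k.2 n
  obtain ⟨c, hc⟩ := Int.eq_ofNat_of_zero_le this
  simp only [chainWeight, Finsupp.add_apply, Finsupp.smul_apply,
    Finsupp.equivFunOnFinite_symm_apply_apply, hc, Int.toNat_natCast, smul_eq_mul]
  rw [← Nat.cast_mul]
  omega

/-- The permutation of `Fin (d * m)` listing the numbers by their residues modulo `d`. -/
def residuePerm (h : N = d * m) : Equiv.Perm (Fin N) :=
  (finCongr h).trans <| finProdFinEquiv.symm.trans <| (Equiv.prodComm _ _).trans <|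
    finProdFinEquiv.trans (finCongr (by rw [h, mul_comm]))

theorem residuePerm_apply (h : N = d * m) (k : Fin N) :
    (residuePerm h k : ℕ) = k / m + d * (k % m) := rfl

/-- The coefficients of `vandermonde * s_ν(x_1^d, …, x_N^d)` at shifted multiples `d * lam` are
cardinalities of sets of chains that are lattice on each block of `m` consecutive entries. -/
theorem coeff_vandermonde_mul_expand_schurPoly (h : N = d * m) (hd : 0 < d)
    (hn : 0 < n) {lam : ℕ → ℕ} (hlam : Antitone lam) :
    open Classical in
    coeff (Finsupp.equivFunOnFinite.symm fun i : Fin N => d * lam i + (N - 1 - (i : ℕ)))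
      (vandermonde N * expand d (schurPoly N hν)) =
      #{g ∈ stripChains N hν | IsLattice (fun i => i + 1 < N ∧ (i + 1) / m = i / m) g ∧
        ∀ k : Fin N, partialContent g k n = lam (k / m + d * (k % m))} := by
  classical
  have hlt : ∀ k < N, k / m < d := fun k hk => Nat.div_lt_of_lt_mul (by rw [mul_comm]; omega)
  set E : Fin N → ℤ := fun i => d * lam i + (N - 1 - (i : ℕ)) with hEdef
  have key := sum_sign_eq_card hν (A := fun i => i + 1 < N ∧ (i + 1) / m = i / m)
    (fun i hi => hi.1) d (fun k => N - 1 - ((k / m + d * (k % m) : ℕ) : ℤ)) ?_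
    (E ∘ residuePerm h) ?_
  · rw [coeff_vandermonde_mul_expand]
    refine Eq.trans ?_ (key.trans ?_)
    · refine Fintype.sum_equiv ((MulAut.conj (residuePerm h)).symm.toEquiv.trans (Equiv.inv _)) _ _
        fun σ => ?_
      rw [← sum_filter, sum_const, nsmul_eq_mul, mul_comm]
      congr 1
      · rw [← contentCount_comp_perm hν hn d (σ⁻¹ * residuePerm h), contentCount]
        congr 2
        refine filter_congr fun g hg => forall_congr' fun k => ?_
        have h1 := (residuePerm h k).2
        rw [residuePerm_apply] at h1
        have h2 : ((N - 1 - (k / m + d * (k % m)) : ℕ) : ℤ) =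
            N - 1 - ((k / m + d * (k % m) : ℕ) : ℤ) := by omega
        have h3 : ((N - 1 - (σ.symm (residuePerm h k) : ℕ) : ℕ) : ℤ) =
            N - 1 - ((σ.symm (residuePerm h k) : ℕ) : ℤ) := by omega
        simp only [Function.comp, Equiv.Perm.mul_apply, Equiv.Perm.inv_def,
          Equiv.apply_symm_apply, Finsupp.equivFunOnFinite_symm_apply_apply, hEdef]
        simp [residuePerm_apply] at h2 h3 ⊢
        rw [h2, h3]
        constructor <;> intro h <;> linarith
      · have := Int.units_coe_mul_self (Equiv.Perm.sign (residuePerm h))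
        simp
        linear_combination -(Equiv.Perm.sign σ : ℤ) * this
    · congr 2
      refine filter_congr fun g hg => and_congr_right fun hl => forall_congr' fun k => ?_
      simp only [Function.comp, hEdef, residuePerm_apply]
      rw [add_left_inj]
      exact mul_right_inj' (by positivity)
  · rintro i ⟨hi, hi'⟩
    have h1 := Nat.div_add_mod i m
    have h2 := Nat.div_add_mod (i + 1) m
    rw [hi'] at h2
    have h3 : (i + 1) % m = i % m + 1 := by omega
    rw [hi', h3]
    push_cast
    ring
  · intro w g hg hl hc
    have hcontent : ∀ k l : ℕ, k ≤ l → l < N → l / m = k / m →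
        partialContent g l n ≤ partialContent g k n := by
      intro k l hkl
      induction l, hkl using Nat.le_induction with
      | base => exact fun _ _ => le_rfl
      | succ l hkl ih =>
        intro hl' hdiv
        have hdiv' : l / m = k / m :=
          le_antisymm ((Nat.div_le_div_right (Nat.le_succ l)).trans hdiv.le)
            (Nat.div_le_div_right hkl)
        refine le_trans ?_ (ih (by omega) hdiv')
        have := not_lt.1 (hl l (n - 1) ⟨hl', by rw [hdiv, hdiv']⟩)
        rw [Nat.sub_add_cancel hn] at this
        refine this.trans ?_
        exact sum_le_sum_of_subset_of_nonneg (range_mono (Nat.sub_le n 1))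
          fun q _ _ => sub_nonneg.2 (hg.le l (by omega) q)
    have hblock : ∀ k : Fin N, (w k : ℕ) / m = (k : ℕ) / m := by
      intro k
      have h1 := hc k
      simp only [Function.comp, hEdef, residuePerm_apply] at h1
      push_cast at h1
      have h2 : ((k / m : ℕ) : ℤ) ≡ ((w k / m : ℕ) : ℤ) [ZMOD d] := by
        rw [Int.modEq_iff_dvd]
        push_cast
        exact ⟨lam (w k / m + d * (w k % m)) - partialContent g k n
          - ((w k % m : ℕ) : ℤ) + ((k % m : ℕ) : ℤ), by push_cast; linarith⟩
      rw [Int.natCast_modEq_iff, Nat.ModEq, Nat.mod_eq_of_lt (hlt _ k.2),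
        Nat.mod_eq_of_lt (hlt _ (w k).2)] at h2
      exact h2.symm
    have hmono : StrictMono w := by
      intro k l hkl
      have hkl' : (k : ℕ) < l := hkl
      rcases (Nat.div_le_div_right (c := m) hkl'.le).lt_or_eq with hlt' | heq
      · rw [← hblock k, ← hblock l] at hlt'
        exact lt_of_not_ge fun hle => hlt'.not_ge (Nat.div_le_div_right hle)
      · by_contra hle
        have hle' : (w l : ℕ) ≤ w k := not_lt.1 hle
        have h1 := hc k
        have h2 := hc l
        simp only [Function.comp, hEdef, residuePerm_apply] at h1 h2
        rw [hblock] at h1 h2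
        have h3 := hcontent k l hkl'.le l.2 heq.symm
        have h4 : (k : ℕ) % m < l % m := by
          have := Nat.div_add_mod (k : ℕ) m
          have := Nat.div_add_mod (l : ℕ) m
          rw [heq] at *
          omega
        have h5 : (w l : ℕ) % m ≤ w k % m := by
          have h6 := Nat.div_add_mod (w k : ℕ) m
          have h7 := Nat.div_add_mod (w l : ℕ) m
          rw [hblock] at h6 h7
          rw [heq] at *
          omega
        have h6 : lam (k / m + d * (w k % m)) ≤ lam (l / m + d * (w l % m)) := by
          rw [heq]
          exact hlam (by gcongr)
        have h7 : d * (k % m) < d * (l % m) := by gcongr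
        have h8 : d * (w l % m) ≤ d * (w k % m) := by gcongr
        have h9 := mul_le_mul_of_nonneg_left h3 (Int.natCast_nonneg d)
        have h10 : d * lam (k / m + d * (w k % m)) ≤ d * lam (l / m + d * (w l % m)) := by gcongr
        rw [heq] at *
        zify at *
        linarith
    ext k
    have := Subsingleton.elim (hmono.orderIsoOfSurjective w w.surjective) (OrderIso.refl _)
    exact congrArg Fin.val (DFunLike.congr_fun this k)

end coeff

/-- The `q`-th part of a partition, in decreasing order and padded with zeros. -/
def partRow {n : ℕ} (P : Nat.Partition n) (q : ℕ) : ℕ := (P.parts.sort (· ≥ ·)).getD q 0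

section partRow
variable {n : ℕ}

theorem length_sort_parts_le (P : Nat.Partition n) : (P.parts.sort (· ≥ ·)).length ≤ n := by
  rw [Multiset.length_sort]
  calc P.parts.card = (P.parts.map fun _ => 1).sum := by simp
    _ ≤ (P.parts.map id).sum := Multiset.sum_map_le_sum_map _ _ fun i hi => P.parts_pos hi
    _ = n := by rw [Multiset.map_id, P.parts_sum]

theorem partRow_eq_zero (P : Nat.Partition n) {q : ℕ} (hq : n ≤ q) : partRow P q = 0 :=
  List.getD_eq_default _ _ ((length_sort_parts_le P).trans hq)

theorem antitone_partRow (P : Nat.Partition n) : Antitone (partRow P) := by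
  intro a b hab
  unfold partRow
  by_cases hb : b < (P.parts.sort (· ≥ ·)).length
  · rw [List.getD_eq_getElem _ _ hb, List.getD_eq_getElem _ _ (hab.trans_lt hb)]
    exact (P.parts.pairwise_sort (· ≥ ·)).rel_get_of_le (a := ⟨a, hab.trans_lt hb⟩)
      (b := ⟨b, hb⟩) hab
  · rw [List.getD_eq_default _ _ (not_lt.1 hb)]
    exact Nat.zero_le _

theorem sum_range_getD (L : List ℕ) {N : ℕ} (h : L.length ≤ N) :
    ∑ q ∈ range N, L.getD q 0 = L.sum := by
  induction L generalizing N with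
  | nil => simp
  | cons a L ih =>
    obtain ⟨N, rfl⟩ : ∃ M, N = M + 1 := ⟨N - 1, by simp at h; omega⟩
    rw [sum_range_succ', List.sum_cons, add_comm]
    simp only [List.getD_cons_succ, List.getD_cons_zero]
    rw [ih (by simpa using h)]

theorem sum_partRow (P : Nat.Partition n) : ∑ q ∈ range n, partRow P q = n := by
  unfold partRow
  rw [sum_range_getD _ (length_sort_parts_le P), ← Multiset.sum_coe, Multiset.sort_eq,
    P.parts_sum]

theorem partRow_injective : Function.Injective (partRow (n := n)) := by
  intro P Q h
  have hpos : ∀ R : Nat.Partition n, ∀ q, q < (R.parts.sort (· ≥ ·)).length ↔ partRow R q ≠ 0 := by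
    intro R q
    unfold partRow
    refine ⟨fun hq => ?_, fun hq => ?_⟩
    · rw [List.getD_eq_getElem _ _ hq]
      exact (R.parts_pos ((Multiset.mem_sort (· ≥ ·)).1 (List.getElem_mem hq))).ne'
    · by_contra hlt
      exact hq (List.getD_eq_default _ _ (not_lt.1 hlt))
  have hlen : (P.parts.sort (· ≥ ·)).length = (Q.parts.sort (· ≥ ·)).length := by
    refine eq_of_forall_lt_iff fun q => ?_
    rw [hpos, hpos, h]
  have : P.parts.sort (· ≥ ·) = Q.parts.sort (· ≥ ·) := by
    refine List.ext_getElem hlen fun q h1 h2 => ?_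
    rw [← List.getD_eq_getElem _ 0 h1, ← List.getD_eq_getElem _ 0 h2]
    exact congrFun h q
  refine Nat.Partition.ext ?_
  rw [← Multiset.sort_eq P.parts (· ≥ ·), this, Multiset.sort_eq]

theorem exists_partRow_eq {f : ℕ → ℕ} (hf : Antitone f) {N : ℕ} (hN : ∀ q, N ≤ q → f q = 0)
    (hsum : ∑ q ∈ range N, f q = n) : ∃ P : Nat.Partition n, partRow P = f := by
  classical
  have hex : ∃ q, f q = 0 := ⟨N, hN N le_rfl⟩
  set L := Nat.find hex with hL
  have hpos : ∀ q < L, 0 < f q := fun q hq => Nat.pos_of_ne_zero (Nat.find_min hex hq)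
  have hzero : ∀ q, L ≤ q → f q = 0 := fun q hq =>
    Nat.le_zero.1 ((hf hq).trans (Nat.find_spec hex).le)
  have hLN : L ≤ N := Nat.find_min' hex (hN N le_rfl)
  have hgetD : ∀ q, ((List.range L).map f).getD q 0 = f q := by
    intro q
    by_cases hq : q < L
    · rw [List.getD_eq_getElem _ _ (by simpa using hq)]
      simp
    · rw [List.getD_eq_default _ _ (by simpa using hq), hzero q (not_lt.1 hq)]
  refine ⟨⟨((List.range L).map f : List ℕ), ?_, ?_⟩, ?_⟩
  · intro i hi
    simp only [Multiset.mem_coe, List.mem_map, List.mem_range] at hi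
    obtain ⟨q, hq, rfl⟩ := hi
    exact hpos q hq
  · rw [Multiset.sum_coe, ← sum_range_getD _ (N := N) (by simpa using hLN), ← hsum]
    exact sum_congr rfl fun q _ => hgetD q
  · have : Multiset.sort (((List.range L).map f : List ℕ) : Multiset ℕ) (· ≥ ·) =
        (List.range L).map f := by
      refine List.Perm.eq_of_pairwise' (r := (· ≥ ·)) (Multiset.pairwise_sort _ _) ?_ ?_
      · rw [List.pairwise_map]
        exact List.pairwise_lt_range.imp fun h => hf h.le
      · rw [← Multiset.coe_eq_coe, Multiset.sort_eq]
    funext q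
    rw [partRow, this, hgetD]

theorem partRow_scale (d : ℕ) (hd : 0 < d) (P : Nat.Partition n) (q : ℕ) :
    partRow (scale d hd P) q = d * partRow P q := by
  have : (scale d hd P).parts.sort (· ≥ ·) = (P.parts.sort (· ≥ ·)).map (d * ·) := by
    refine List.Perm.eq_of_pairwise' (r := (· ≥ ·)) (Multiset.pairwise_sort _ _) ?_ ?_
    · rw [List.pairwise_map]
      exact (Multiset.pairwise_sort _ _).imp fun h => Nat.mul_le_mul_left d h
    · rw [← Multiset.coe_eq_coe, Multiset.sort_eq, ← Multiset.map_coe, Multiset.sort_eq]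
      rfl
  unfold partRow
  rw [this]
  simpa using List.getD_map (l := P.parts.sort (· ≥ ·)) (d := 0) (n := q) (f := (d * ·))

end partRow
section schur
variable {n : ℕ}

theorem cast_partRow_eq_zero (P : Nat.Partition n) (q : ℕ) (hq : n ≤ q) :
    (partRow P q : ℤ) = 0 := by rw [partRow_eq_zero P hq, Nat.cast_zero]

/-- The Schur polynomial of a partition in `N` variables. -/
noncomputable def schur (N : ℕ) (P : Nat.Partition n) : MvPolynomial (Fin N) ℤ :=
  schurPoly N (cast_partRow_eq_zero P)

/-- The exponent vector `P + (N - 1, N - 2, …, 0)`. -/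
noncomputable def shiftedRow (N : ℕ) (P : Nat.Partition n) : Fin N →₀ ℕ :=
  Finsupp.equivFunOnFinite.symm fun i : Fin N => partRow P i + (N - 1 - (i : ℕ))

theorem IsStripChain.eq_zero_of_le {N : ℕ} {ν : ℕ → ℤ} {g : ℕ → ℕ → ℤ} (h : IsStripChain N ν g)
    {i q : ℕ} (hi : i ≤ N) (hq : i ≤ q) : g i q = 0 := by
  induction i generalizing q with
  | zero => simp [h.zero]
  | succ i ih =>
    obtain ⟨q, rfl⟩ : ∃ p, q = p + 1 := ⟨q - 1, by omega⟩
    exact le_antisymm ((h.strip i hi q).trans (ih (by omega) (by omega)).le) (h.nonneg hi _)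

theorem IsStripChain.eq_of_isLattice {N : ℕ} {ν : ℕ → ℤ} {g : ℕ → ℕ → ℤ}
    (h : IsStripChain N ν g) (hν : ∀ q, N ≤ q → ν q = 0)
    (hg : IsLattice (fun i => i + 1 < N) g) :
    g = fun i q => if q < i then ν q else 0 := by
  have h1 : ∀ i < N, partialContent g i i ≤ 0 := by
    intro i
    induction i with
    | zero => simp [partialContent]
    | succ i ih => exact fun hi => (not_lt.1 (hg i i hi)).trans (ih (by omega))
  have h2 : ∀ i < N, ∀ q < i, g (i + 1) q = g i q := by
    intro i hi q hq
    have h3 := (sum_eq_zero_iff_of_nonneg fun q _ => sub_nonneg.2 (h.le i hi q)).1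
      (le_antisymm (h1 i hi) (h.partialContent_nonneg hi i)) q (mem_range.2 hq)
    exact sub_eq_zero.1 h3
  have h3 : ∀ i ≤ N, ∀ q < i, g i q = ν q := by
    intro i hi
    induction hi using Nat.decreasingInduction with
    | self => exact fun q _ => by rw [h.top N le_rfl]
    | of_succ i hi ih => exact fun q hq => by rw [← h2 i hi q hq, ih q (by omega)]
  funext i q
  split_ifs with hq
  · rcases le_total i N with hi | hi
    · exact h3 i hi q hq
    · rw [h.top i hi]
  · rcases le_total i N with hi | hi
    · exact h.eq_zero_of_le hi (not_lt.1 hq)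
    · rw [h.top i hi, hν q (by omega)]

theorem isStripChain_ite {N : ℕ} {ν : ℕ → ℤ} (hν : ∀ q, N ≤ q → ν q = 0) (hanti : Antitone ν)
    (hnonneg : ∀ q, 0 ≤ ν q) : IsStripChain N ν fun i q => if q < i then ν q else 0 := by
  refine ⟨?_, ?_, ?_, ?_⟩
  · funext q
    simp
  · intro i hi
    funext q
    split_ifs with h
    · rfl
    · rw [hν q (by omega)]
  · intro i _ q
    have := hnonneg q
    split_ifs <;> omega
  · intro i _ q
    have := hanti (Nat.le_succ q)
    split_ifs <;> omega

theorem partialContent_ite (ν : ℕ → ℤ) (i r : ℕ) :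
    partialContent (fun i q => if q < i then ν q else 0) i r = if i < r then ν i else 0 := by
  have h : ∀ q, (if q < i + 1 then ν q else 0) - (if q < i then ν q else 0) =
      if q = i then ν q else 0 := fun q => by
    split_ifs <;> omega
  simp only [partialContent, h, sum_ite_eq', mem_range]

theorem coeff_vandermonde_mul_schur {N : ℕ} (hn : 0 < n) (hN : n ≤ N) (P Q : Nat.Partition n) :
    coeff (shiftedRow N P) (vandermonde N * schur N Q) = if P = Q then 1 else 0 := by
  classical
  have hν : ∀ q, N ≤ q → (partRow Q q : ℤ) = 0 := fun q hq => cast_partRow_eq_zero Q q (hN.trans hq)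
  have h := coeff_vandermonde_mul_expand_schurPoly (cast_partRow_eq_zero Q) (d := 1) (m := N)
    (one_mul N).symm one_pos hn (antitone_partRow P)
  simp only [one_mul, expand_one_apply] at h
  rw [shiftedRow, schur, h]
  set g₀ : ℕ → ℕ → ℤ := fun i q => if q < i then (partRow Q q : ℤ) else 0
  have hanti : Antitone fun q => (partRow Q q : ℤ) :=
    fun a b hab => Nat.cast_le.2 (antitone_partRow Q hab)
  have hlat : ∀ g, IsLattice (fun i => i + 1 < N ∧ (i + 1) / N = i / N) g ↔
      IsLattice (fun i => i + 1 < N) g := by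
    intro g
    refine forall_congr' fun i => forall_congr' fun r => imp_congr_left ?_
    refine and_iff_left_of_imp fun hi => ?_
    rw [Nat.div_eq_of_lt hi, Nat.div_eq_of_lt (by omega)]
  have hcont : ∀ k, partialContent g₀ k n = partRow Q k := by
    intro k
    rw [partialContent_ite]
    split_ifs with hk
    · rfl
    · rw [cast_partRow_eq_zero Q k (by omega)]
  have hidx : ∀ k : Fin N, (k : ℕ) / N + k % N = k := fun k => by
    rw [Nat.div_eq_of_lt k.2, Nat.mod_eq_of_lt k.2, zero_add]
  have hiff : ∀ g, (g ∈ stripChains N (cast_partRow_eq_zero Q) ∧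
      IsLattice (fun i => i + 1 < N ∧ (i + 1) / N = i / N) g ∧
        ∀ k : Fin N, partialContent g k n = partRow P (k / N + k % N)) ↔ P = Q ∧ g = g₀ := by
    intro g
    rw [hlat, mem_stripChains]
    constructor
    · rintro ⟨h1, h2, h3⟩
      have h4 : g = g₀ := h1.eq_of_isLattice hν h2
      refine ⟨partRow_injective (funext fun k => ?_), h4⟩
      by_cases hk : k < N
      · have := h3 ⟨k, hk⟩
        rw [h4, hcont, hidx] at this
        exact_mod_cast this.symm
      · rw [partRow_eq_zero P (by omega), partRow_eq_zero Q (by omega)]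
    · rintro ⟨rfl, rfl⟩
      refine ⟨isStripChain_ite hν hanti fun q => Int.natCast_nonneg _, fun i r _ => ?_, fun k => ?_⟩
      · rw [IsViolation, partialContent_ite, partialContent_ite, not_lt]
        have := hanti (Nat.le_succ i)
        simp only [add_lt_add_iff_right]
        split_ifs
        · exact this
        · exact le_rfl
      · rw [hcont, hidx]
  rw [filter_congr_decidable]
  split_ifs with hPQ
  · rw [Nat.cast_eq_one, card_eq_one]
    exact ⟨g₀, by ext g; rw [mem_filter, hiff]; simp [hPQ]⟩
  · rw [Nat.cast_eq_zero, card_eq_zero]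
    ext g
    rw [mem_filter, hiff]
    simp [hPQ]

end schur

section alternating
variable {N n : ℕ}

/-- A polynomial on which permutations of the variables act by their sign. -/
def IsAlternating (F : MvPolynomial (Fin N) ℤ) : Prop :=
  ∀ τ : Equiv.Perm (Fin N), rename τ F = C (Equiv.Perm.sign τ : ℤ) * F

theorem mapDomain_equivFunOnFinite_symm (τ : Equiv.Perm (Fin N)) (f : Fin N → ℕ) :
    (Finsupp.equivFunOnFinite.symm f).mapDomain τ = Finsupp.equivFunOnFinite.symm (f ∘ τ.symm) := by
  ext k
  obtain ⟨k, rfl⟩ := τ.surjective k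
  rw [Finsupp.mapDomain_apply τ.injective]
  simp

theorem isAlternating_vandermonde : IsAlternating (vandermonde N) := by
  intro τ
  rw [vandermonde_eq_sum, map_sum, mul_sum]
  refine Fintype.sum_equiv (Equiv.mulRight τ⁻¹) _ _ fun σ => ?_
  rw [rename_monomial, mapDomain_equivFunOnFinite_symm, C_mul_monomial]
  congr 1
  have := Int.units_coe_mul_self (Equiv.Perm.sign τ)
  simp
  linear_combination -(Equiv.Perm.sign σ : ℤ) * this

theorem IsAlternating.mul_isSymmetric {F D : MvPolynomial (Fin N) ℤ} (hF : IsAlternating F)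
    (hD : D.IsSymmetric) : IsAlternating (F * D) := fun τ => by
  rw [map_mul, hF τ, hD τ, mul_assoc]

theorem IsAlternating.coeff_comp {F : MvPolynomial (Fin N) ℤ} (hF : IsAlternating F)
    (τ : Equiv.Perm (Fin N)) (e : Fin N → ℕ) :
    coeff (Finsupp.equivFunOnFinite.symm e) F =
      Equiv.Perm.sign τ * coeff (Finsupp.equivFunOnFinite.symm (e ∘ τ)) F := by
  have h : Finsupp.equivFunOnFinite.symm e =
      (Finsupp.equivFunOnFinite.symm (e ∘ τ)).mapDomain τ := by
    rw [mapDomain_equivFunOnFinite_symm]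
    congr 1
    ext k
    simp
  have h2 := congrArg (coeff (Finsupp.equivFunOnFinite.symm e)) (hF τ)
  rw [coeff_C_mul] at h2
  conv_lhs at h2 => rw [h, coeff_rename_mapDomain _ τ.injective]
  have := Int.units_coe_mul_self (Equiv.Perm.sign τ)
  linear_combination (Equiv.Perm.sign τ : ℤ) * (-h2) -
    (coeff (Finsupp.equivFunOnFinite.symm e) F) * this

theorem IsAlternating.eq_zero {F : MvPolynomial (Fin N) ℤ} (hF : IsAlternating F)
    (h : ∀ e : Fin N → ℕ, StrictAnti e → coeff (Finsupp.equivFunOnFinite.symm e) F = 0) :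
    F = 0 := by
  ext e
  obtain ⟨e, rfl⟩ := Finsupp.equivFunOnFinite.symm.surjective e
  rw [coeff_zero]
  by_cases he : Function.Injective e
  · have hmono : Antitone (e ∘ Tuple.sort (OrderDual.toDual ∘ e)) :=
      fun i j hij => Tuple.monotone_sort (OrderDual.toDual ∘ e) hij
    rw [hF.coeff_comp (Tuple.sort (OrderDual.toDual ∘ e)),
      h _ (hmono.strictAnti_of_injective (he.comp (Equiv.injective _))), mul_zero]
  · obtain ⟨i, j, hij, hne⟩ : ∃ i j, e i = e j ∧ i ≠ j := by
      simpa [Function.Injective] using he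
    have h1 := hF.coeff_comp (Equiv.swap i j) e
    have h2 : e ∘ Equiv.swap i j = e := by
      ext k
      by_cases hi : k = i
      · simp [hi, hij]
      by_cases hj : k = j
      · simp [hj, hij]
      simp [Equiv.swap_apply_of_ne_of_ne hi hj]
    rw [h2, Equiv.Perm.sign_swap hne] at h1
    simp at h1
    omega

theorem exists_shiftedRow_eq {e : Fin N → ℕ} (he : StrictAnti e)
    (hsum : ∑ i, e i = n + ∑ i : Fin N, (N - 1 - (i : ℕ))) :
    ∃ P : Nat.Partition n, shiftedRow N P = Finsupp.equivFunOnFinite.symm e := by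
  have hstep : ∀ i j : ℕ, ∀ (hj : j < N) (hij : i ≤ j), e ⟨j, hj⟩ + (j - i) ≤ e ⟨i, by omega⟩ := by
    intro i j hj hij
    induction j, hij using Nat.le_induction with
    | base => simp
    | succ j hij ih =>
      have h1 := ih (by omega)
      have h2 : e ⟨j + 1, hj⟩ < e ⟨j, by omega⟩ := he (Nat.lt_succ_self j)
      omega
  set f : ℕ → ℕ := fun q => if h : q < N then e ⟨q, h⟩ - (N - 1 - q) else 0 with hf
  have hfe : ∀ i : Fin N, f i + (N - 1 - (i : ℕ)) = e i := by
    intro i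
    have hi := i.2
    have h1 := hstep i (N - 1) (by omega) (by omega)
    simp only [hf, dif_pos i.2, Fin.eta]
    simp only [Fin.eta] at h1
    omega
  have hanti : Antitone f := by
    intro i j hij
    by_cases hj : j < N
    · have := hstep i j hj hij
      simp only [hf, dif_pos hj, dif_pos (hij.trans_lt hj)]
      omega
    · exact (dif_neg hj).trans_le (Nat.zero_le _)
  obtain ⟨P, hP⟩ := exists_partRow_eq (n := n) hanti (N := N) (fun q hq => dif_neg (not_lt.2 hq)) (by
    rw [← Fin.sum_univ_eq_sum_range f N]
    have : ∑ i, e i = ∑ i : Fin N, f i + ∑ i : Fin N, (N - 1 - (i : ℕ)) := by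
      rw [← sum_add_distrib]
      exact sum_congr rfl fun i _ => (hfe i).symm
    exact Nat.add_right_cancel (this.symm.trans hsum))
  refine ⟨P, ?_⟩
  rw [shiftedRow, hP]
  congr 1
  ext i
  exact hfe i

theorem isHomogeneous_vandermonde :
    (vandermonde N).IsHomogeneous (∑ i : Fin N, (N - 1 - (i : ℕ))) := by
  rw [vandermonde_eq_sum]
  refine IsHomogeneous.sum _ _ _ fun σ _ => isHomogeneous_monomial _ ?_
  rw [Finsupp.degree_eq_sum]
  exact Equiv.sum_comp σ fun i : Fin N => N - 1 - (i : ℕ)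

theorem vandermonde_ne_zero : vandermonde N ≠ 0 := by
  rw [vandermonde, prod_ne_zero_iff]
  intro p hp h
  rw [mem_filter] at hp
  exact hp.2.ne (X_injective (sub_eq_zero.1 h))

theorem eq_zero_of_coeff_vandermonde_mul {D : MvPolynomial (Fin N) ℤ}
    (hsymm : D.IsSymmetric) (hhom : D.IsHomogeneous n)
    (h : ∀ P : Nat.Partition n, coeff (shiftedRow N P) (vandermonde N * D) = 0) : D = 0 := by
  refine (mul_eq_zero.1 ?_).resolve_left (vandermonde_ne_zero (N := N))
  refine (isAlternating_vandermonde.mul_isSymmetric hsymm).eq_zero fun e he => ?_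
  by_cases hsum : ∑ i, e i = n + ∑ i : Fin N, (N - 1 - (i : ℕ))
  · obtain ⟨P, hP⟩ := exists_shiftedRow_eq he hsum
    rw [← hP, h]
  · refine (isHomogeneous_vandermonde.mul hhom).coeff_eq_zero ?_
    rw [Finsupp.degree_eq_sum, add_comm]
    exact hsum

theorem isSymmetric_schur (hn : 0 < n) (P : Nat.Partition n) : (schur N P).IsSymmetric := by
  intro τ
  ext e
  obtain ⟨e, rfl⟩ := (Finsupp.mapDomain_surjective (M := ℕ) τ.surjective) e
  rw [coeff_rename_mapDomain _ τ.injective, schur, coeff_schurPoly, coeff_schurPoly,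
    ← contentCount_comp_perm _ hn 1 τ fun k => ((e.mapDomain τ k : ℕ) : ℤ)]
  congr 2
  ext k
  simp

theorem isHomogeneous_schur (P : Nat.Partition n) : (schur N P).IsHomogeneous n := by
  refine IsHomogeneous.sum _ _ _ fun g hg => isHomogeneous_monomial _ ?_
  rw [mem_stripChains] at hg
  rw [Finsupp.degree_eq_sum]
  zify
  have h : ∀ k : Fin N, ((chainWeight N n g k : ℕ) : ℤ) = partialContent g k n := fun k =>
    Int.toNat_of_nonneg (hg.partialContent_nonneg k.2 n)
  simp_rw [h]
  rw [Fin.sum_univ_eq_sum_range fun k => partialContent g k n]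
  simp only [partialContent]
  rw [sum_comm]
  have h2 : ∀ q, ∑ i ∈ range N, (g (i + 1) q - g i q) = partRow P q := fun q => by
    rw [sum_range_sub fun i => g i q, hg.top N le_rfl, hg.zero, Pi.zero_apply, sub_zero]
  simp_rw [h2]
  exact_mod_cast sum_partRow P

theorem isSymmetric_pprod (mu : Nat.Partition n) : (pprod N mu).IsSymmetric := by
  refine multiset_prod_mem (S := symmetricSubalgebra (Fin N) ℤ) _ fun p hp => ?_
  obtain ⟨r, -, rfl⟩ := Multiset.mem_map.1 hp
  exact psum_isSymmetric _ _ r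

theorem isHomogeneous_pprod (mu : Nat.Partition n) : (pprod N mu).IsHomogeneous n := by
  rw [pprod]
  have : ∀ s : Multiset ℕ, (s.map (_root_.psum N)).prod.IsHomogeneous s.sum := by
    intro s
    induction s using Multiset.induction with
    | empty => exact isHomogeneous_one _ _
    | cons r s ih =>
      rw [Multiset.map_cons, Multiset.prod_cons, Multiset.sum_cons]
      exact (IsHomogeneous.sum _ _ _ fun i _ => isHomogeneous_X_pow i r).mul ih
  simpa only [mu.parts_sum] using this mu.parts

end alternating

section stability
variable {n : ℕ}

theorem killCompl_X_castSucc (M : ℕ) (i : Fin M) :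
    killCompl (R := ℤ) (Fin.castSucc_injective M) (X i.castSucc) = X i := by
  rw [← rename_X Fin.castSucc, killCompl_rename_app]

theorem killCompl_X_last (M : ℕ) :
    killCompl (R := ℤ) (Fin.castSucc_injective M) (X (Fin.last M)) = 0 := by
  rw [killCompl, aeval_X, dif_neg]
  rintro ⟨i, hi⟩
  exact (Fin.castSucc_lt_last i).ne hi

theorem killCompl_vandermonde (M : ℕ) : killCompl (Fin.castSucc_injective M) (vandermonde (M + 1)) =
    (∏ i : Fin M, X i) * vandermonde M := by
  simp only [vandermonde, prod_filter, Fintype.prod_prod_type, Fin.prod_univ_castSucc]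
  simp [apply_ite (killCompl (R := ℤ) (Fin.castSucc_injective M)),
    killCompl_X_castSucc, killCompl_X_last, prod_mul_distrib, mul_comm, Fin.castSucc_lt_last,
    (Fin.castSucc_lt_last _).not_gt]

theorem killCompl_pprod (M : ℕ) (mu : Nat.Partition n) :
    killCompl (Fin.castSucc_injective M) (pprod (M + 1) mu) = pprod M mu := by
  rw [pprod, pprod, map_multiset_prod, Multiset.map_map]
  congr 1
  refine Multiset.map_congr rfl fun r hr => ?_
  simp [_root_.psum, Fin.sum_univ_castSucc, killCompl_X_castSucc, killCompl_X_last,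
    (mu.parts_pos hr).ne']

theorem coeff_shiftedRow_succ {M : ℕ} (hM : n ≤ M) (P mu : Nat.Partition n) :
    coeff (shiftedRow (M + 1) P) (vandermonde (M + 1) * pprod (M + 1) mu) =
      coeff (shiftedRow M P) (vandermonde M * pprod M mu) := by
  have h1 : (∏ i : Fin M, X i : MvPolynomial (Fin M) ℤ) =
      monomial (Finsupp.equivFunOnFinite.symm 1) 1 := by
    rw [monomial_eq, Finsupp.prod_fintype _ _ fun _ => pow_zero _]
    simp
  have h2 : shiftedRow (M + 1) P =
      (Finsupp.equivFunOnFinite.symm 1 + shiftedRow M P).mapDomain Fin.castSucc := by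
    ext k
    refine Fin.lastCases ?_ (fun k => ?_) k
    · rw [Finsupp.mapDomain_of_notMem_range]
      · simp [shiftedRow, partRow_eq_zero P hM]
      · rintro ⟨i, hi⟩
        exact (Fin.castSucc_lt_last i).ne hi
    · rw [Finsupp.mapDomain_apply (Fin.castSucc_injective M)]
      simp [shiftedRow]
      omega
  rw [h2, ← coeff_killCompl (Fin.castSucc_injective M), map_mul, killCompl_vandermonde,
    killCompl_pprod, h1, mul_assoc, coeff_monomial_mul, one_mul]

theorem coeff_shiftedRow_eq_chi {N : ℕ} (hN : n ≤ N) (P mu : Nat.Partition n) :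
    coeff (shiftedRow N P) (vandermonde N * pprod N mu) = chi P mu := by
  induction N, hN using Nat.le_induction with
  | base => rfl
  | succ M hM ih => rw [coeff_shiftedRow_succ hM, ih]

/-- The Frobenius formula, solved for the power sums: `p_μ = ∑_ν χ^ν_μ s_ν`. -/
theorem pprod_eq_sum_schur {N : ℕ} (hn : 0 < n) (hN : n ≤ N) (mu : Nat.Partition n) :
    pprod N mu = ∑ nu : Nat.Partition n, C (chi nu mu) * schur N nu := by
  rw [← sub_eq_zero]
  refine eq_zero_of_coeff_vandermonde_mul (n := n) ?_ ?_ fun P => ?_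
  · exact (isSymmetric_pprod mu).sub <| sum_mem (S := symmetricSubalgebra (Fin N) ℤ) fun nu _ =>
      (IsSymmetric.C _).mul (isSymmetric_schur hn nu)
  · exact (isHomogeneous_pprod mu).sub <| IsHomogeneous.sum _ _ _ fun nu _ =>
      (isHomogeneous_schur nu).C_mul _
  · rw [mul_sub, coeff_sub, coeff_shiftedRow_eq_chi hN, mul_sum, coeff_sum]
    simp_rw [mul_left_comm (vandermonde N), coeff_C_mul, coeff_vandermonde_mul_schur hn hN]
    simp

theorem expand_pprod (N d : ℕ) (hd : 0 < d) (mu : Nat.Partition n) :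
    expand d (pprod N mu) = pprod N (scale d hd mu) := by
  rw [pprod, pprod, map_multiset_prod, Multiset.map_map, scale, Multiset.map_map]
  congr 1
  refine Multiset.map_congr rfl fun r _ => ?_
  simp [_root_.psum, pow_mul]

end stability

/-- For `d ≥ 1` and `λ ⊢ n ≥ 1`, the class function `μ ↦ χ^{d·λ}_{d·μ}` on `S_n` is a
genuine character, i.e. a nonnegative integer combination of the irreducible characters. -/
theorem scale_class_function_is_character (d n : ℕ) (hd : 1 ≤ d) (hn : 1 ≤ n)
    (lam : Nat.Partition n) :
    ∃ a : Nat.Partition n → ℕ,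
      ∀ mu : Nat.Partition n,
        chi (scale d hd lam) (scale d hd mu) =
          ∑ nu : Nat.Partition n, (a nu : ℤ) * chi nu mu := by
  choose a ha using fun nu : Nat.Partition n => (⟨_, coeff_vandermonde_mul_expand_schurPoly
    (cast_partRow_eq_zero nu) (rfl : d * n = d * n) hd hn (antitone_partRow lam)⟩ :
      ∃ a : ℕ, coeff _ (vandermonde (d * n) * expand d (schurPoly (d * n) _)) = a)
  refine ⟨a, fun mu => ?_⟩
  rw [← coeff_shiftedRow_eq_chi le_rfl, ← expand_pprod, pprod_eq_sum_schur hn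
    (Nat.le_mul_of_pos_left n hd), map_sum, mul_sum, coeff_sum]
  refine sum_congr rfl fun nu _ => ?_
  rw [map_mul, expand_C, mul_left_comm, coeff_C_mul, mul_comm, ← ha]
  simp only [shiftedRow, partRow_scale, schur]
end

section
/- Let d ≥ 1, n ≥ 1, and let (τ_1, …, τ_d) be a d-tuple of partitions of n whose multiset union τ_1 ⊎ ⋯ ⊎ τ_d equals the partition μ of dn. For each partition π of n let σ_π := #{ j ∈ {1,…,d} : τ_j = π } be the number of coordinates of the tuple equal to π. Then (∏_{π ⊢ n} σ_π!) · z_{τ_1} ⋯ z_{τ_d} divides z_μ; equivalently, ∏_{π ⊢ n} σ_π! divides the product of multinomial coefficients ∏_{i≥1} m_i(μ)!/(m_i(τ_1)! ⋯ m_i(τ_d)!). -/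
open MvPolynomial Finset

/-- The centralizer order `z_λ = ∏_i i^{m_i(λ)} m_i(λ)!`. -/
def zpart {n : ℕ} (P : Nat.Partition n) : ℕ :=
  ∏ i ∈ Finset.range (n + 1), i ^ (P.parts.count i) * (P.parts.count i).factorial

theorem factorial_mul_factorial_pow_dvd_factorial_mul (s a : ℕ) (ha : a ≠ 0) :
    s.factorial * a.factorial ^ s ∣ (s * a).factorial :=
  ⟨Nat.uniformBell s a, by rw [← Nat.uniformBell_mul_eq s ha]; ring⟩

theorem factorial_pow_dvd_factorial_mul (s a : ℕ) : a.factorial ^ s ∣ (s * a).factorial := by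
  simpa using Nat.prod_factorial_dvd_factorial_sum (Finset.range s) fun _ => a

/-- The multinomial coefficient of the family `w (f j)` is divisible by the product of the
factorials of the sizes of any fibers of `f` over points of nonzero weight `w`. -/
theorem prod_factorial_card_fiber_mul_prod_factorial_dvd {ι κ : Type*} [Fintype ι] [Fintype κ]
    [DecidableEq κ] (f : ι → κ) (w : κ → ℕ) (S : Finset κ) (hS : ∀ k ∈ S, w k ≠ 0) :
    (∏ k ∈ S, (#{j | f j = k}).factorial) * ∏ j, (w (f j)).factorial
      ∣ (∑ j, w (f j)).factorial := by
  have hprod : ∏ j, (w (f j)).factorial = ∏ k, (w k).factorial ^ #{j | f j = k} := by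
    rw [← Finset.prod_fiberwise (g := f)]
    refine Finset.prod_congr rfl fun k _ => ?_
    rw [Finset.prod_congr rfl fun j hj => by rw [(Finset.mem_filter.mp hj).2]]
    simp
  have hsum : ∑ j, w (f j) = ∑ k, #{j | f j = k} * w k := by
    rw [← Finset.sum_fiberwise (g := f)]
    refine Finset.sum_congr rfl fun k _ => ?_
    rw [Finset.sum_congr rfl fun j hj => by rw [(Finset.mem_filter.mp hj).2]]
    simp
  rw [hprod, hsum]
  refine dvd_trans ?_ (Nat.prod_factorial_dvd_factorial_sum _ _)
  rw [← Finset.prod_ite_mem_eq S, ← Finset.prod_mul_distrib]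
  refine Finset.prod_dvd_prod_of_dvd _ _ fun k _ => ?_
  split_ifs with hk
  · exact factorial_mul_factorial_pow_dvd_factorial_mul _ _ (hS k hk)
  · simpa using factorial_pow_dvd_factorial_mul _ _

theorem zpart_eq_prod_range {n N : ℕ} (P : Nat.Partition n) (h : n ≤ N) :
    zpart P = ∏ i ∈ Finset.range (N + 1),
      i ^ (P.parts.count i) * (P.parts.count i).factorial := by
  refine Finset.prod_subset (Finset.range_subset_range.mpr (by omega)) fun i _ hi => ?_
  have hc : P.parts.count i = 0 := Multiset.count_eq_zero.mpr fun hm => by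
    have := P.le_of_mem_parts hm
    simp at hi
    omega
  simp [hc]

/-- If the multiset union of the `d`-tuple `(τ_1, …, τ_d)` of partitions of `n ≥ 1` is the
partition `μ` of `dn`, and `σ_π` counts the coordinates of the tuple equal to `π`, then
`(∏_π σ_π!) ⋅ z_{τ_1} ⋯ z_{τ_d}` divides `z_μ`; equivalently, `∏_π σ_π!` divides the
product of multinomial coefficients `∏_i m_i(μ)!/(m_i(τ_1)!⋯m_i(τ_d)!)`. -/
theorem multiplicity_factorials_dvd (d n : ℕ) (hd : 1 ≤ d) (hn : 1 ≤ n)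
    (τ : Fin d → Nat.Partition n) (mu : Nat.Partition (d * n))
    (hτ : (∑ j, (τ j).parts) = mu.parts) :
    (∏ pi : Nat.Partition n, ((Finset.univ.filter fun j => τ j = pi).card).factorial)
        * ∏ j, zpart (τ j) ∣ zpart mu
    ∧ (∏ pi : Nat.Partition n, ((Finset.univ.filter fun j => τ j = pi).card).factorial)
        ∣ ∏ i ∈ Finset.range (d * n + 1),
            (mu.parts.count i).factorial / ∏ j, ((τ j).parts.count i).factorial := by
  have hle : n ≤ d * n := Nat.le_mul_of_pos_left n hd
  have hpart (P : Nat.Partition n) : ∃ i, i ∈ P.parts := by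
    refine Multiset.exists_mem_of_ne_zero fun h => ?_
    have := P.parts_sum
    simp [h] at this
    omega
  choose part hmem using hpart
  have hcount (i : ℕ) : mu.parts.count i = ∑ j, (τ j).parts.count i := by
    rw [← hτ, Multiset.count_sum']
  have hfactor (i : ℕ) := prod_factorial_card_fiber_mul_prod_factorial_dvd τ
    (fun P => P.parts.count i) {P | part P = i} fun P hP => by
      rw [← (Finset.mem_filter.mp hP).2]
      exact (Multiset.count_pos.mpr (hmem P)).ne'
  have hfiber : ∏ P, (#{j | τ j = P}).factorial =
      ∏ i ∈ Finset.range (d * n + 1), ∏ P with part P = i, (#{j | τ j = P}).factorial := by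
    refine (Finset.prod_fiberwise_of_maps_to (fun P _ => ?_) _).symm
    have := P.le_of_mem_parts (hmem P)
    simp
    omega
  rw [hfiber]
  constructor
  · simp_rw [zpart_eq_prod_range _ hle]
    rw [Finset.prod_comm, ← Finset.prod_mul_distrib, zpart]
    refine Finset.prod_dvd_prod_of_dvd _ _ fun i _ => ?_
    rw [Finset.prod_mul_distrib, Finset.prod_pow_eq_pow_sum, hcount, mul_left_comm]
    exact mul_dvd_mul_left _ (hfactor i)
  · refine Finset.prod_dvd_prod_of_dvd _ _ fun i _ => Nat.dvd_div_of_mul_dvd ?_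
    rw [hcount, mul_comm]
    exact hfactor i
end

section
/- Let a_1, …, a_d be natural numbers and for each integer v ≥ 1 let m_v := #{ i ∈ {1,…,d} : a_i = v } be the number of indices whose entry equals v. Then (∏_{v ≥ 1} m_v!) · a_1! ⋯ a_d! divides (a_1 + ⋯ + a_d)!; that is, the multinomial coefficient (a_1+⋯+a_d)!/(a_1!⋯a_d!) is divisible by the product of the factorials of the multiplicities of the distinct nonzero values among a_1, …, a_d. -/
open MvPolynomial Finset

/-- For natural numbers `a_1, …, a_d`, letting `m_v` be the number of indices `i` with
`a_i = v` for each `v ≥ 1`, the product `(∏_{v ≥ 1} m_v!) ⋅ a_1! ⋯ a_d!` divides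
`(a_1 + ⋯ + a_d)!`. -/
theorem multiplicity_factorials_mul_factorials_dvd (d : ℕ) (a : Fin d → ℕ) :
    (∏ v ∈ Finset.Icc 1 (∑ i, a i),
        ((Finset.univ.filter fun i => a i = v).card).factorial)
      * ∏ i, (a i).factorial ∣ (∑ i, a i).factorial := by
  classical
  set m : Multiset ℕ := Finset.univ.val.map a with hm
  have hcount (v : ℕ) :
      (Finset.univ.filter fun i => a i = v).card = m.count v := by
    rw [hm, Multiset.count_map, Finset.card_def, Finset.filter_val]
    simp only [eq_comm]
  have hsum : m.sum = ∑ i, a i := rfl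
  have hprod : (m.map Nat.factorial).prod = ∏ i, (a i).factorial := by
    rw [hm, Multiset.map_map]
    rfl
  have hsupport : ∏ v ∈ m.toFinset.erase 0, (m.count v).factorial
      = ∏ v ∈ Finset.Icc 1 (∑ i, a i), (m.count v).factorial := by
    refine Finset.prod_subset (fun v hv => ?_) (fun v hv hv' => ?_)
    · rw [Finset.mem_erase, Multiset.mem_toFinset] at hv
      rw [Finset.mem_Icc, ← hsum]
      exact ⟨Nat.pos_of_ne_zero hv.1, Multiset.le_sum_of_mem hv.2⟩
    · have hv0 : v ≠ 0 := Nat.one_le_iff_ne_zero.mp (Finset.mem_Icc.mp hv).1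
      have hvm : v ∉ m := fun h =>
        hv' (Finset.mem_erase.mpr ⟨hv0, Multiset.mem_toFinset.mpr h⟩)
      rw [Multiset.count_eq_zero_of_notMem hvm, Nat.factorial_zero]
  simp only [hcount]
  refine ⟨m.bell, ?_⟩
  rw [← hsupport, ← hprod, ← hsum, ← Multiset.bell_mul_eq m]
  ring
end
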